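/- arXiv:1308.0747 — 2 statements merged into one kernel-verified Lean document; each statement's English description precedes it below -/
import Mathlib

section
/- Let n ≥ 1 and let Δ be a function from GL_n(R) to the n×n matrices over R such that for every integer m ≥ 1 and all a, b ∈ GL_n(R) with a ≡ b mod p^m one has Δ(a) ≡ Δ(b) mod p^m. Let ν ≥ 1 be an integer and suppose Δ(φ^ν(a)) = φ^ν(Δ(a)) for all a ∈ GL_n(R) (φ^ν applied entrywise). Let u₀ ∈ GL_n(R) and let α be an n×n matrix over R with φ^ν(u₀) = u₀ and φ^ν(α) = α, i.e., their entries lie in the fixed ring R^{φ^ν} (which is a complete valuation subring of R). If u ∈ GL_n(R) satisfies u ≡ u₀ mod p and φ(u) = (1+pα)·(u^(p) + p·Δ(u)), then φ^ν(u) = u; i.e., all entries of u lie in R^{φ^ν}. -/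
noncomputable section

/-- `R = W(k)`, `k` the algebraic closure of `𝔽_p`. -/
abbrev Rp (p : ℕ) [Fact p.Prime] : Type _ :=
  WittVector p (AlgebraicClosure (ZMod p))

/-- `φ`, the unique Frobenius lift on `R`. -/
abbrev frobW (p : ℕ) [Fact p.Prime] : Rp p →+* Rp p :=
  WittVector.frobenius

/-- Congruent elements modulo `p ^ m`, `m ≥ 1`, have `p`-th powers congruent modulo `p ^ (m + 1)`. -/
theorem pow_succ_dvd_pow_sub_pow {A : Type*} [CommRing A] {p m : ℕ} (hm : 1 ≤ m) {a b : A}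
    (h : (p : A) ^ m ∣ a - b) : (p : A) ^ (m + 1) ∣ a ^ p - b ^ p := by
  rw [← geom_sum₂_mul, pow_succ']
  exact mul_dvd_mul (dvd_geom_sum₂_self ((dvd_pow_self _ (by omega)).trans h)) h

/-- The Frobenius of `W(k)` reflects divisibility by powers of `p`. -/
theorem pow_dvd_of_pow_dvd_frobW {p : ℕ} [Fact p.Prime] {m : ℕ} {x : Rp p}
    (h : (p : Rp p) ^ m ∣ frobW p x) : (p : Rp p) ^ m ∣ x := by
  obtain ⟨c, hc⟩ := h
  obtain ⟨d, rfl⟩ := (WittVector.frobenius_bijective p (AlgebraicClosure (ZMod p))).2 c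
  refine ⟨d, (WittVector.frobenius_bijective p (AlgebraicClosure (ZMod p))).1 ?_⟩
  rw [map_mul, map_pow, map_natCast]
  exact hc

/-- `W(k)` is `p`-adically separated. -/
theorem eq_zero_of_forall_pow_dvd {p : ℕ} [Fact p.Prime] {x : Rp p}
    (h : ∀ m : ℕ, (p : Rp p) ^ (m + 1) ∣ x) : x = 0 := by
  by_contra hx
  obtain ⟨m, hm⟩ := FiniteMultiplicity.of_not_isUnit
    (WittVector.irreducible (p := p) (k := AlgebraicClosure (ZMod p))).not_isUnit hx
  exact hm (h m)

/-- Two invertible solutions of `φ(u) = (1 + pα)(u^(p) + pΔ(u))` congruent modulo `p` are equal. -/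
theorem solution_unique {p : ℕ} [Fact p.Prime] {n : ℕ}
    {Δ : Matrix (Fin n) (Fin n) (Rp p) → Matrix (Fin n) (Fin n) (Rp p)}
    (hΔ : ∀ m : ℕ, 1 ≤ m → ∀ a b : Matrix (Fin n) (Fin n) (Rp p),
      IsUnit a → IsUnit b → (∀ i j, (p : Rp p) ^ m ∣ (a i j - b i j)) →
      ∀ i j, (p : Rp p) ^ m ∣ (Δ a i j - Δ b i j))
    {α u v : Matrix (Fin n) (Fin n) (Rp p)} (hu : IsUnit u) (hv : IsUnit v)
    (hcong : ∀ i j, (p : Rp p) ∣ (u i j - v i j))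
    (hequ : u.map (frobW p) =
      (1 + (p : Rp p) • α) * (u.map (· ^ p) + (p : Rp p) • Δ u))
    (heqv : v.map (frobW p) =
      (1 + (p : Rp p) • α) * (v.map (· ^ p) + (p : Rp p) • Δ v)) : u = v := by
  have key : ∀ m : ℕ, ∀ i j, (p : Rp p) ^ (m + 1) ∣ (u i j - v i j) := by
    intro m
    induction m with
    | zero => simpa using hcong
    | succ m ih =>
      intro i j
      apply pow_dvd_of_pow_dvd_frobW
      have hsub : frobW p (u i j - v i j) = ((1 + (p : Rp p) • α) *
          ((u.map (· ^ p) + (p : Rp p) • Δ u) - (v.map (· ^ p) + (p : Rp p) • Δ v))) i j := by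
        rw [mul_sub, ← hequ, ← heqv, map_sub]
        rfl
      rw [hsub, Matrix.mul_apply]
      refine Finset.dvd_sum fun l _ => Dvd.dvd.mul_left ?_ _
      have hΔl := hΔ (m + 1) (by omega) u v hu hv ih l j
      have hpow := pow_succ_dvd_pow_sub_pow (by omega) (ih l j)
      have hsplit : ((u.map (· ^ p) + (p : Rp p) • Δ u) -
          (v.map (· ^ p) + (p : Rp p) • Δ v)) l j =
          (u l j ^ p - v l j ^ p) + p * (Δ u l j - Δ v l j) := by
        simp only [Matrix.sub_apply, Matrix.add_apply, Matrix.map_apply, Matrix.smul_apply,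
          smul_eq_mul]
        ring
      rw [hsplit]
      refine dvd_add hpow ?_
      rw [pow_succ']
      exact mul_dvd_mul_left _ hΔl
  ext1 i j
  exact sub_eq_zero.mp (eq_zero_of_forall_pow_dvd fun m => key m i j)

/-- if `Δ` commutes with `φ^ν` and the data `u₀, α` have entries fixed
by `φ^ν`, then the solution `u` of `φ(u) = (1+pα)·(u^(p) + pΔ(u))` with `u ≡ u₀ mod p`
has all its entries fixed by `φ^ν`. -/
theorem statement1 {p : ℕ} [Fact p.Prime] (hp2 : p ≠ 2)
    (δ : Rp p → Rp p) (hδ : ∀ a, frobW p a = a ^ p + p * δ a)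
    (n : ℕ) (hn : 1 ≤ n)
    (Δ : Matrix (Fin n) (Fin n) (Rp p) → Matrix (Fin n) (Fin n) (Rp p))
    (hΔ : ∀ m : ℕ, 1 ≤ m → ∀ a b : Matrix (Fin n) (Fin n) (Rp p),
      IsUnit a → IsUnit b → (∀ i j, (p : Rp p) ^ m ∣ (a i j - b i j)) →
      ∀ i j, (p : Rp p) ^ m ∣ (Δ a i j - Δ b i j))
    (ν : ℕ) (hν : 1 ≤ ν)
    (hΔφ : ∀ a : Matrix (Fin n) (Fin n) (Rp p), IsUnit a →
      Δ (a.map ((⇑(frobW p))^[ν])) = (Δ a).map ((⇑(frobW p))^[ν]))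
    (u₀ : Matrix (Fin n) (Fin n) (Rp p)) (hu₀ : IsUnit u₀)
    (hu₀fix : ∀ i j, (⇑(frobW p))^[ν] (u₀ i j) = u₀ i j)
    (α : Matrix (Fin n) (Fin n) (Rp p))
    (hαfix : ∀ i j, (⇑(frobW p))^[ν] (α i j) = α i j)
    (u : Matrix (Fin n) (Fin n) (Rp p)) (hu : IsUnit u)
    (hcong : ∀ i j, (p : Rp p) ∣ (u i j - u₀ i j))
    (heq : u.map (frobW p) =
      (1 + (p : Rp p) • α) * (u.map (· ^ p) + (p : Rp p) • Δ u)) :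
    ∀ i j, (⇑(frobW p))^[ν] (u i j) = u i j := by
  obtain ⟨ψ, hψ⟩ : ∃ ψ : Rp p →+* Rp p, (⇑(frobW p))^[ν] = ψ :=
    ⟨frobW p ^ ν, (RingHom.coe_pow _ _).symm⟩
  have hcomm : ∀ x, frobW p (ψ x) = ψ (frobW p x) := fun x => by
    rw [← hψ, ← Function.iterate_succ_apply' (frobW p), Function.iterate_succ_apply]
  rw [hψ] at hu₀fix hαfix hΔφ ⊢
  have hv : IsUnit (u.map ψ) := hu.map ψ.mapMatrix
  have hvcong : ∀ i j, (p : Rp p) ∣ (u.map ψ i j - u i j) := by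
    intro i j
    have h := map_dvd ψ (hcong i j)
    rw [map_natCast, map_sub, hu₀fix] at h
    simpa using dvd_sub h (hcong i j)
  have hα : α.map ψ = α := Matrix.ext hαfix
  have hveq : (u.map ψ).map (frobW p) = (1 + (p : Rp p) • α) *
      ((u.map ψ).map (· ^ p) + (p : Rp p) • Δ (u.map ψ)) := by
    have h := congrArg ψ.mapMatrix heq
    rw [map_mul, map_add, map_add, map_one] at h
    have hsmul : ∀ M : Matrix (Fin n) (Fin n) (Rp p),
        ψ.mapMatrix ((p : Rp p) • M) = (p : Rp p) • M.map ψ := fun M => by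
      ext1 i j
      simp
    rw [hsmul, hsmul, hα, ← hΔφ u hu] at h
    have hl : ψ.mapMatrix (u.map (frobW p)) = (u.map ψ).map (frobW p) :=
      Matrix.ext fun i j => (hcomm (u i j)).symm
    have hr : ψ.mapMatrix (u.map (· ^ p)) = (u.map ψ).map (· ^ p) :=
      Matrix.ext fun i j => map_pow ψ (u i j) p
    rwa [hl, hr] at h
  have huniq := solution_unique hΔ hv hu hvcong hveq heq
  exact fun i j => congrFun (congrFun huniq i) j
end
end

section
/- Let m ≥ 1, let E be a countable subfield of the fraction field K of R, and let X_1, …, X_m ⊆ R be open balls, i.e., sets of the form X_j = b_j + p^{N_j}·R with b_j ∈ R and N_j ≥ 0. Then there exists a meagre subset Ω of the topological space X = X_1 × … × X_m such that for every u = (u_1,…,u_m) ∈ X \ Ω, the countable family (δ^i u_j)_{i ≥ 0, 1 ≤ j ≤ m}, regarded as a family of elements of K, is algebraically independent over E. -/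
set_option synthInstance.maxHeartbeats 1000000
set_option maxHeartbeats 1000000

noncomputable section

/-- `K`, the fraction field of `R`. -/
abbrev Kp (p : ℕ) [Fact p.Prime] : Type _ := FractionRing (Rp p)

/-- The `p`-adic topology on `R`. -/
instance RpTop (p : ℕ) [Fact p.Prime] : TopologicalSpace (Rp p) :=
  (Ideal.span {(p : Rp p)}).adicTopology

open MvPolynomial

/-- A surjective endomorphism of a Noetherian commutative ring is injective. -/
theorem RingHom.injective_of_surjective_of_isNoetherianRing {A : Type*} [CommRing A]
    [IsNoetherianRing A] (f : A →+* A) (hf : Function.Surjective f) : Function.Injective f := by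
  have hmono : Monotone fun n : ℕ => RingHom.ker (f ^ n) := by
    refine monotone_nat_of_le_succ fun n x hx => ?_
    rw [RingHom.mem_ker] at hx ⊢
    rw [pow_succ', RingHom.mul_def, RingHom.comp_apply, hx, map_zero]
  obtain ⟨n, hn⟩ := monotone_stabilizes_iff_noetherian.mpr ‹IsNoetherianRing A› ⟨_, hmono⟩
  have hsurj : Function.Surjective (f ^ n) := by
    rw [RingHom.coe_pow]
    exact hf.iterate n
  refine (injective_iff_map_eq_zero f).mpr fun x hx => ?_
  obtain ⟨y, rfl⟩ := hsurj x
  have hy : y ∈ RingHom.ker (f ^ (n + 1)) := by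
    rw [RingHom.mem_ker, pow_succ', RingHom.mul_def, RingHom.comp_apply, hx]
  have h := hn (n + 1) n.le_succ
  simp only [OrderHom.coe_mk] at h
  rwa [← h, RingHom.mem_ker] at hy

/-- The operator `x ↦ (σ x - x ^ p) / p` attached to an endomorphism `σ` of a `ℚ`-algebra. -/
def frobQuotient {A : Type*} [CommRing A] [Algebra ℚ A] (p : ℕ) (σ : A →+* A) (x : A) : A :=
  (p : ℚ)⁻¹ • (σ x - x ^ p)

section frobQuotient

variable {A B : Type*} [CommRing A] [Algebra ℚ A] [CommRing B] [Algebra ℚ B] {p : ℕ}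

theorem map_frobQuotient_iterate (f : A →+* B) (σ : A →+* A) (τ : B →+* B)
    (h : ∀ x, f (σ x) = τ (f x)) (i : ℕ) (x : A) :
    f ((frobQuotient p σ)^[i] x) = (frobQuotient p τ)^[i] (f x) := by
  refine Function.Semiconj.iterate_right (f := f) (fun y => ?_) i x
  simp only [frobQuotient, map_rat_smul, map_sub, map_pow, h]

theorem apply_eq_pow_add_frobQuotient (hp : p ≠ 0) (σ : A →+* A) (x : A) :
    σ x = x ^ p + p * frobQuotient p σ x := by
  have h : (p : A) = algebraMap ℚ A p := by simp
  rw [frobQuotient, h, ← Algebra.smul_def, smul_smul,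
    mul_inv_cancel₀ (Nat.cast_ne_zero.mpr hp), one_smul, add_sub_cancel]

/-- Iterates of `σ` are polynomials in the iterates of `frobQuotient p σ`. -/
theorem iterate_mem_adjoin_frobQuotient {K : Type*} [CommRing K] [Algebra K A] (hp : p ≠ 0)
    (σ : A →+* A) (σK : K →+* K) (hσ : ∀ c, σ (algebraMap K A c) = algebraMap K A (σK c))
    (y : A) (i : ℕ) :
    σ^[i] y ∈ Algebra.adjoin K {x | ∃ k ≤ i, x = (frobQuotient p σ)^[k] y} := by
  induction i with
  | zero => exact Algebra.subset_adjoin ⟨0, le_rfl, rfl⟩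
  | succ i ih =>
    rw [Function.iterate_succ_apply']
    generalize σ^[i] y = w at ih
    set S := Algebra.adjoin K {x | ∃ k ≤ i + 1, x = (frobQuotient p σ)^[k] y}
    have hS : ∀ k ≤ i + 1, (frobQuotient p σ)^[k] y ∈ S :=
      fun k hk => Algebra.subset_adjoin ⟨k, hk, rfl⟩
    induction ih using Algebra.adjoin_induction with
    | mem x hx =>
      obtain ⟨k, hk, rfl⟩ := hx
      rw [apply_eq_pow_add_frobQuotient hp σ, ← Function.iterate_succ_apply' (frobQuotient p σ)]
      exact add_mem (pow_mem (hS k (by omega)) p)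
        (mul_mem (natCast_mem _ _) (hS (k + 1) (by omega)))
    | algebraMap r => rw [hσ]; exact S.algebraMap_mem _
    | add x z _ _ hx hz => rw [map_add]; exact add_mem hx hz
    | mul x z _ _ hx hz => rw [map_mul]; exact mul_mem hx hz

/-- A polynomial over `K` vanishing at all the `frobQuotient`-jets of a family of affine subspaces
spanned by sufficiently many powers of an element with distinct `σ`-conjugates is zero. -/
theorem eq_zero_of_eval_frobQuotient_eq_zero {K κ : Type*} [Field K] [CharZero K] [Finite κ]
    (hp : p ≠ 0) (σ : K →+* K) (n : ℕ) (s : K)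
    (hs : Function.Injective fun i : Fin n => σ^[i] s)
    (a : κ → K) (c : K) (hc : c ≠ 0) (hσc : σ c = c) (F : MvPolynomial (Fin n × κ) K)
    (hF : ∀ t : Fin n × κ → ℕ, eval (fun q : Fin n × κ => (frobQuotient p σ)^[q.1]
      (a q.2 + c * ∑ l : Fin n, (t (l, q.2) : K) * s ^ (l : ℕ))) F = 0) : F = 0 := by
  let σP : MvPolynomial (Fin n × κ) K →+* MvPolynomial (Fin n × κ) K := map σ
  let Y : κ → MvPolynomial (Fin n × κ) K := fun j =>
    C (a j) + C c * ∑ l : Fin n, X (l, j) * C (s ^ (l : ℕ))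
  let Q : Fin n × κ → MvPolynomial (Fin n × κ) K := fun q => (frobQuotient p σP)^[q.1] (Y q.2)
  have hY : ∀ i j, σP^[i] (Y j) =
      C (σ^[i] (a j)) + C c * ∑ l : Fin n, X (l, j) * C ((σ^[i] s) ^ (l : ℕ)) := by
    intro i j
    induction i with
    | zero => rfl
    | succ i ih => simp [Function.iterate_succ_apply', ih, σP, hσc]
  let S := (aeval (R := K) Q).range
  have hQ : ∀ (i : Fin n) j, σP^[i] (Y j) ∈ S := by
    intro i j
    refine Algebra.adjoin_le ?_ (iterate_mem_adjoin_frobQuotient (K := K) hp σP σ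
      (fun c => by simp [σP, algebraMap_eq]) (Y j) i)
    rintro _ ⟨k, hk, rfl⟩
    exact ⟨X (⟨k, by omega⟩, j), by simp [Q]⟩
  let V := Matrix.vandermonde fun i : Fin n => σ^[i] s
  have hV : IsUnit V.det := (Matrix.det_vandermonde_ne_zero_iff.mpr hs).isUnit
  have hlin : ∀ (i : Fin n) j, ∑ l, V i l • X (l, j) ∈ S := by
    intro i j
    have h : ∑ l, V i l • X (l, j) = c⁻¹ • (σP^[i] (Y j) - C (σ^[i] (a j))) := by
      rw [hY, add_sub_cancel_left, ← smul_eq_C_mul, smul_smul, inv_mul_cancel₀ hc, one_smul]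
      exact Finset.sum_congr rfl fun l _ => by rw [smul_eq_C_mul, mul_comm]; rfl
    rw [h]
    exact S.smul_mem (sub_mem (hQ i j) (S.algebraMap_mem _)) _
  have hX : ∀ (l : Fin n) j, X (l, j) ∈ S := by
    intro l j
    have h : (X (l, j) : MvPolynomial (Fin n × κ) K) =
        ∑ i, V⁻¹ l i • ∑ l', V i l' • X (l', j) := by
      simp_rw [Finset.smul_sum, smul_smul]
      rw [Finset.sum_comm]
      simp_rw [← Finset.sum_smul, ← Matrix.mul_apply, Matrix.nonsing_inv_mul V hV,
        Matrix.one_apply, ite_smul, one_smul, zero_smul]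
      simp
    rw [h]
    exact sum_mem fun i _ => S.smul_mem (hlin i j) _
  have hsurj : Function.Surjective (aeval (R := K) Q) := by
    rw [← AlgHom.range_eq_top, eq_top_iff, ← adjoin_range_X]
    refine Algebra.adjoin_le ?_
    rintro _ ⟨⟨l, j⟩, rfl⟩
    exact hX l j
  refine RingHom.injective_of_surjective_of_isNoetherianRing (aeval (R := K) Q).toRingHom hsurj ?_
  change aeval Q F = aeval Q 0
  rw [map_zero]
  refine funext_set (fun _ => Set.range ((↑) : ℕ → K))
    (fun _ => Set.infinite_range_of_injective Nat.cast_injective) fun x hx => ?_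
  choose t ht using fun q => hx q (Set.mem_univ q)
  obtain rfl : (fun q => (t q : K)) = x := funext ht
  have hcomm : ∀ P, eval (fun q => (t q : K)) (σP P) = σ (eval (fun q => (t q : K)) P) := by
    intro P
    induction P using MvPolynomial.induction_on with
    | C r => simp [σP]
    | add P P' h h' => simp only [map_add, h, h']
    | mul_X P q h => rw [map_mul, map_mul, map_mul, map_mul, h]; simp [σP]
  rw [map_zero, ← hF t, ← RingHom.coe_coe (aeval Q), ← RingHom.comp_apply]
  congr 1
  refine ringHom_ext (fun r => by simp) fun q => ?_
  simp only [RingHom.comp_apply, RingHom.coe_coe, aeval_X, eval_X]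
  rw [map_frobQuotient_iterate _ σP σ hcomm]
  simp [Y]

end frobQuotient

section WittVector

variable {p : ℕ} [Fact p.Prime]

theorem natCast_prime_ne_zero_Rp : (p : Rp p) ≠ 0 :=
  WittVector.p_nonzero p _

instance charZero_Rp : CharZero (Rp p) := by
  refine charZero_of_inj_zero fun n hn => ?_
  by_contra hn0
  obtain ⟨k, n', hn', rfl⟩ := Nat.exists_eq_pow_mul_and_not_dvd hn0 p (Fact.out : p.Prime).ne_one
  rw [Nat.cast_mul, Nat.cast_pow, mul_eq_zero] at hn
  rcases hn with hn | hn
  · exact natCast_prime_ne_zero_Rp (by_contra fun h => pow_ne_zero k h hn)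
  · have h := congrArg WittVector.constantCoeff hn
    rw [map_natCast, map_zero, CharP.cast_eq_zero_iff _ p] at h
    exact hn' h

instance isTopologicalRing_Rp : IsTopologicalRing (Rp p) :=
  (Ideal.span {(p : Rp p)}).nonarchimedean.toIsTopologicalRing

theorem hasBasis_nhds_Rp (a : Rp p) :
    (nhds a).HasBasis (fun _ : ℕ => True) fun n => {y | (p : Rp p) ^ n ∣ y - a} := by
  refine ((Ideal.span {(p : Rp p)}).hasBasis_nhds_adic a).to_hasBasis' (fun n _ => ⟨n, trivial, ?_⟩)
    fun n _ => ?_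
  · intro y hy
    refine ⟨y - a, ?_, add_sub_cancel _ _⟩
    rwa [SetLike.mem_coe, Ideal.span_singleton_pow, Ideal.mem_span_singleton]
  · refine Filter.mem_of_superset
      (((Ideal.span {(p : Rp p)}).hasBasis_nhds_adic a).mem_of_mem (i := n) trivial) ?_
    rintro _ ⟨x, hx, rfl⟩
    rw [SetLike.mem_coe, Ideal.span_singleton_pow, Ideal.mem_span_singleton] at hx
    simpa using hx

instance t1Space_Rp : T1Space (Rp p) := by
  refine t1Space_iff_exists_open.mpr fun x y hxy => ?_
  have hne : y - x ≠ 0 := sub_ne_zero.mpr hxy.symm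
  obtain ⟨n, hn⟩ : ∃ n, ¬ (p : Rp p) ^ n ∣ y - x := by
    obtain ⟨n, hn⟩ := FiniteMultiplicity.of_prime_left
      (WittVector.irreducible p).prime hne
    exact ⟨_, hn⟩
  have := (hasBasis_nhds_Rp x).mem_of_mem (i := n) trivial
  obtain ⟨U, hU, hUo, hxU⟩ := mem_nhds_iff.mp this
  exact ⟨U, hUo, hxU, fun hy => hn (hU hy)⟩

theorem continuous_of_frobenius_eq {δ : Rp p → Rp p}
    (hδ : ∀ a, frobW p a = a ^ p + p * δ a) : Continuous δ := by
  refine continuous_iff_continuousAt.mpr fun a =>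
    ((hasBasis_nhds_Rp a).tendsto_iff (hasBasis_nhds_Rp _)).mpr fun n _ => ⟨n + 1, trivial, ?_⟩
  intro y hy
  have h1 : (p : Rp p) ^ (n + 1) ∣ frobW p y - frobW p a := by
    simpa using map_dvd (frobW p) hy
  have h2 : (p : Rp p) ^ (n + 1) ∣ y ^ p - a ^ p := dvd_trans hy (sub_dvd_pow_sub_pow y a p)
  have h3 : (p : Rp p) * p ^ n ∣ p * (δ y - δ a) := by
    have h := dvd_sub h1 h2
    rw [hδ, hδ] at h
    rw [← pow_succ']
    convert h using 1
    ring
  exact (mul_dvd_mul_iff_left natCast_prime_ne_zero_Rp).mp h3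

/-- There are elements of `R` with arbitrarily many distinct Frobenius conjugates. -/
theorem exists_injective_frobenius_iterate (n : ℕ) :
    ∃ s : Rp p, Function.Injective fun i : Fin n => (frobW p)^[i] s := by
  have hp1 := (Fact.out : p.Prime).one_lt
  let k := AlgebraicClosure (ZMod p)
  let P : Polynomial k :=
    ∏ ij ∈ (Finset.univ : Finset (Fin n × Fin n)).filter fun ij => ij.1 ≠ ij.2,
      (Polynomial.X ^ p ^ (ij.1 : ℕ) - Polynomial.X ^ p ^ (ij.2 : ℕ))
  have hP : P ≠ 0 := by
    refine Finset.prod_ne_zero_iff.mpr fun ij hij h => ?_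
    have h' := congrArg Polynomial.natDegree (sub_eq_zero.mp h)
    rw [Polynomial.natDegree_X_pow, Polynomial.natDegree_X_pow] at h'
    exact (Finset.mem_filter.mp hij).2 (Fin.ext (Nat.pow_right_injective hp1 h'))
  obtain ⟨α, hα⟩ : ∃ α : k, P.eval α ≠ 0 := by
    by_contra! h
    exact hP (Polynomial.funext (by simpa using h))
  refine ⟨WittVector.teichmuller p α, fun i j hij => ?_⟩
  have hcoeff : ∀ i : ℕ, ((frobW p)^[i] (WittVector.teichmuller p α)).coeff 0 = α ^ p ^ i := by
    intro i
    induction i with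
    | zero => simp
    | succ i ih =>
      rw [Function.iterate_succ_apply', WittVector.coeff_frobenius_charP, ih, ← pow_mul, pow_succ]
  by_contra hne
  refine hα ?_
  rw [Polynomial.eval_prod]
  refine Finset.prod_eq_zero (i := (i, j)) (by simpa using hne) ?_
  have h := congrArg (fun x => WittVector.coeff x 0) hij
  simp only [hcoeff] at h
  simp [h]

/-- The zero set of a polynomial over `K` in continuous `R`-valued functions is closed. -/
theorem isClosed_eval_algebraMap_eq_zero {T ι : Type*} [TopologicalSpace T]
    (g : ι → T → Rp p) (hg : ∀ i, Continuous (g i)) (F : MvPolynomial ι (Kp p)) :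
    IsClosed {u | eval (fun i => algebraMap (Rp p) (Kp p) (g i u)) F = 0} := by
  obtain ⟨c, hc⟩ := IsLocalization.exist_integer_multiples (nonZeroDivisors (Rp p)) F.support
    fun d => F.coeff d
  obtain ⟨G, hG⟩ : ∃ G : MvPolynomial ι (Rp p),
      map (algebraMap (Rp p) (Kp p)) G = (c : Rp p) • F := by
    refine mem_range_map_iff_coeffs_subset.mpr fun x hx => ?_
    obtain ⟨d, hd, rfl⟩ := mem_coeffs_iff.mp hx
    by_cases hd' : d ∈ F.support
    · rw [coeff_smul]
      exact hc d hd'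
    · exact ⟨0, by rw [coeff_smul, notMem_support_iff.mp hd', smul_zero, map_zero]⟩
  have hset : {u | eval (fun i => algebraMap (Rp p) (Kp p) (g i u)) F = 0} =
      {u | eval (fun i => g i u) G = 0} := by
    ext u
    have h : algebraMap (Rp p) (Kp p) (eval (fun i => g i u) G) =
        (c : Rp p) • eval (fun i => algebraMap (Rp p) (Kp p) (g i u)) F := by
      rw [map_eval, hG, Algebra.smul_def, Algebra.smul_def, map_mul,
        MvPolynomial.algebraMap_apply, eval_C, Function.comp_def]
    rw [Set.mem_ofPred_eq, Set.mem_ofPred_eq,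
      ← (FaithfulSMul.algebraMap_injective (Rp p) (Kp p)).eq_iff, h, map_zero,
      smul_eq_zero, or_iff_right (nonZeroDivisors.coe_ne_zero c)]
  rw [hset]
  refine isClosed_singleton.preimage (f := fun u => eval (fun i => g i u) G) ?_
  exact (continuous_eval G).comp (continuous_pi hg)

/-- The Frobenius of `K`. -/
def frobK (p : ℕ) [Fact p.Prime] : Kp p →+* Kp p :=
  IsFractionRing.map (j := frobW p) (WittVector.frobenius_bijective p _).injective

theorem frobK_algebraMap (x : Rp p) :
    frobK p (algebraMap (Rp p) (Kp p) x) = algebraMap (Rp p) (Kp p) (frobW p x) :=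
  IsLocalization.map_eq (M := nonZeroDivisors (Rp p)) (T := nonZeroDivisors (Rp p))
    (nonZeroDivisors_le_comap_nonZeroDivisors_of_injective _
      (WittVector.frobenius_bijective p _).injective) x

theorem frobK_iterate_algebraMap (i : ℕ) (x : Rp p) :
    (frobK p)^[i] (algebraMap (Rp p) (Kp p) x) = algebraMap (Rp p) (Kp p) ((frobW p)^[i] x) :=
  (Function.Semiconj.iterate_right (f := algebraMap (Rp p) (Kp p))
    (fun y => (frobK_algebraMap y).symm) i x).symm

instance charZero_Kp : CharZero (Kp p) :=
  charZero_of_injective_algebraMap (FaithfulSMul.algebraMap_injective (Rp p) (Kp p))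

theorem algebraMap_iterate_eq_frobQuotient {δ : Rp p → Rp p}
    (hδ : ∀ a, frobW p a = a ^ p + p * δ a) (i : ℕ) (x : Rp p) :
    algebraMap (Rp p) (Kp p) (δ^[i] x) =
      (frobQuotient p (frobK p))^[i] (algebraMap (Rp p) (Kp p) x) := by
  refine Function.Semiconj.iterate_right (f := algebraMap (Rp p) (Kp p)) (fun y => ?_) i x
  have hp : (p : Kp p) ≠ 0 := Nat.cast_ne_zero.mpr (Fact.out : p.Prime).ne_zero
  have h := apply_eq_pow_add_frobQuotient (Fact.out : p.Prime).ne_zero (frobK p)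
    (algebraMap (Rp p) (Kp p) y)
  rw [frobK_algebraMap, hδ, map_add, map_pow, map_mul, map_natCast] at h
  exact mul_left_cancel₀ hp (add_left_cancel h)

/-- A polynomial over `K` in the `δ`-jets of `m` elements which vanishes on a ball is zero. -/
theorem eq_zero_of_eval_delta_eq_zero {δ : Rp p → Rp p}
    (hδ : ∀ a, frobW p a = a ^ p + p * δ a) {κ : Type*} [Finite κ] (a : κ → Rp p) (M : ℕ)
    (F : MvPolynomial (ℕ × κ) (Kp p))
    (hF : ∀ w : κ → Rp p, eval (fun q : ℕ × κ => algebraMap (Rp p) (Kp p)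
      (δ^[q.1] (a q.2 + (p : Rp p) ^ M * w q.2))) F = 0) : F = 0 := by
  have hp0 : p ≠ 0 := (Fact.out : p.Prime).ne_zero
  obtain ⟨n, hn⟩ : ∃ n, ∀ q ∈ F.vars, q.1 < n :=
    ⟨F.vars.sup Prod.fst + 1, fun q hq => Nat.lt_succ_of_le (Finset.le_sup (f := Prod.fst) hq)⟩
  obtain ⟨G, rfl⟩ := exists_rename_eq_of_vars_subset_range F
    (Prod.map Fin.val id : Fin n × κ → ℕ × κ)
    (Fin.val_injective.prodMap Function.injective_id)
    fun q hq => ⟨(⟨q.1, hn q hq⟩, q.2), rfl⟩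
  obtain ⟨s, hs⟩ := exists_injective_frobenius_iterate (p := p) n
  suffices G = 0 by rw [this, map_zero]
  refine eq_zero_of_eval_frobQuotient_eq_zero (p := p) hp0 (frobK p) n
    (algebraMap (Rp p) (Kp p) s) ?_ (fun j => algebraMap (Rp p) (Kp p) (a j)) ((p : Kp p) ^ M)
    (pow_ne_zero M (Nat.cast_ne_zero.mpr hp0)) (by simp) G fun t => ?_
  · simp only [frobK_iterate_algebraMap]
    exact (FaithfulSMul.algebraMap_injective (Rp p) (Kp p)).comp hs
  · have h := hF fun j => ∑ l : Fin n, (t (l, j) : Rp p) * s ^ (l : ℕ)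
    rw [eval_rename] at h
    rw [← h]
    congr 2
    funext q
    simp [algebraMap_iterate_eq_frobQuotient hδ]

end WittVector

/-- outside a meagre subset of a product of open balls
`X₁ × … × X_m ⊆ R^m`, the family `(δ^i u_j)` is algebraically independent over any
fixed countable subfield `E` of `K`. -/
theorem statement16 {p : ℕ} [Fact p.Prime] (hp2 : p ≠ 2)
    (δ : Rp p → Rp p) (hδ : ∀ a, frobW p a = a ^ p + p * δ a)
    (m : ℕ) (hm : 1 ≤ m)
    (E : Subfield (Kp p)) (hE : Countable E)
    (b : Fin m → Rp p) (N : Fin m → ℕ) :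
    ∃ Ω : Set {u : Fin m → Rp p // ∀ j, ∃ r : Rp p, u j = b j + (p : Rp p) ^ (N j) * r},
      IsMeagre Ω ∧
      ∀ u : {u : Fin m → Rp p // ∀ j, ∃ r : Rp p, u j = b j + (p : Rp p) ^ (N j) * r},
        u ∉ Ω →
        ∀ f : MvPolynomial (ℕ × Fin m) (↥E),
          MvPolynomial.eval₂ E.subtype
            (fun q => algebraMap (Rp p) (Kp p) (δ^[q.1] ((u : Fin m → Rp p) q.2))) f = 0 →
          f = 0 := by
  let T := {u : Fin m → Rp p // ∀ j, ∃ r : Rp p, u j = b j + (p : Rp p) ^ (N j) * r}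
  let x : T → ℕ × Fin m → Kp p := fun u q => algebraMap (Rp p) (Kp p) (δ^[q.1] (u.1 q.2))
  let Z : {f : MvPolynomial (ℕ × Fin m) E // f ≠ 0} → Set T :=
    fun f => {u | eval (x u) (map E.subtype f.1) = 0}
  have : Countable (MvPolynomial (ℕ × Fin m) E) := by
    rw [← Cardinal.mk_le_aleph0_iff]
    refine cardinalMk_le_max_lift.trans (max_le (max_le ?_ ?_) le_rfl)
    · exact Cardinal.lift_le_aleph0.mpr (Cardinal.mk_le_aleph0_iff.mpr hE)
    · exact Cardinal.lift_le_aleph0.mpr (Cardinal.mk_le_aleph0_iff.mpr inferInstance)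
  refine ⟨⋃ f, Z f, isMeagre_iUnion fun f => ?_, fun u hu f hf => ?_⟩
  · have hclosed : IsClosed (Z f) := by
      have hcont : ∀ q : ℕ × Fin m, Continuous fun u : T => δ^[q.1] (u.1 q.2) := by
        intro q
        have hδq : Continuous δ^[q.1] := (continuous_of_frobenius_eq hδ).iterate q.1
        have hq : Continuous fun u : T => u.1 q.2 :=
          (continuous_apply q.2).comp continuous_subtype_val
        exact hδq.comp hq
      exact isClosed_eval_algebraMap_eq_zero _ hcont (map E.subtype f.1)
    refine (hclosed.isNowhereDense_iff.mpr ?_).isMeagre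
    refine Set.eq_empty_of_forall_notMem fun u hu => f.2 ?_
    obtain ⟨V, hV, hVZ⟩ := mem_nhds_subtype _ _ _ |>.mp (mem_interior_iff_mem_nhds.mp hu)
    rw [nhds_pi, Filter.mem_pi'] at hV
    obtain ⟨I, W, hW, hWV⟩ := hV
    choose L hL using fun j => (hasBasis_nhds_Rp (u.1 j)).mem_iff.mp (hW j)
    let M := Finset.univ.sup fun j => max (L j) (N j)
    have hM : ∀ j, max (L j) (N j) ≤ M :=
      fun j => Finset.le_sup (f := fun j => max (L j) (N j)) (Finset.mem_univ j)
    have hzero : map E.subtype f.1 = 0 := by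
      refine eq_zero_of_eval_delta_eq_zero hδ u.1 M _ fun w => ?_
      have hmem : ∀ j, ∃ r : Rp p,
          u.1 j + (p : Rp p) ^ M * w j = b j + (p : Rp p) ^ (N j) * r := by
        intro j
        obtain ⟨r, hr⟩ := u.2 j
        obtain ⟨d, hd⟩ := pow_dvd_pow (p : Rp p) ((le_max_right _ _).trans (hM j))
        exact ⟨r + d * w j, by rw [hr, hd]; ring⟩
      refine hVZ (a := (⟨fun j => u.1 j + (p : Rp p) ^ M * w j, hmem⟩ : T)) (hWV fun j _ => ?_)
      refine (hL j).2 ?_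
      rw [Set.mem_ofPred_eq, add_sub_cancel_left]
      exact (pow_dvd_pow _ ((le_max_left _ _).trans (hM j))).mul_right _
    exact map_injective _ E.subtype.injective (by rw [hzero, map_zero])
  · by_contra hne
    refine hu (Set.mem_iUnion.mpr ⟨⟨f, hne⟩, ?_⟩)
    rwa [eval₂_eq_eval_map] at hf
end
end
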